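/- Let q ≥ 1, d ≥ 1, let 𝒳 ⊆ ℝ^d be compact, D_in ⊆ 𝒳 nonempty closed, and let Φ₀ : ℝ^d → ℝ be (q+1)-times continuously differentiable. Let (Ω, 𝔉, P) be a probability space carrying random points X₁, X₂, … with values in D_in and, for each n ∈ ℕ, a random q-times continuously differentiable function Φ̂_n : Ω × ℝ^d → ℝ. Assume (with all appearing suprema measurable): (a) for every multi-index 𝛂 ∈ ℕ^d with |𝛂| ≤ q, sup_{x∈D_in} |∂^𝛂 Φ̂_n(x) − ∂^𝛂 Φ₀(x)| → 0 in probability as n → ∞ (for |𝛂| = 0 this is sup_{x∈D_in} |Φ̂_n(x) − Φ₀(x)| → 0 in probability); (b) Λ_n := sup_{z∈D_in} min_{k∈{1,…,n}} ‖X_k − z‖₂ → 0 in probability. Define the plug-in estimates B̂_n^lo(x) := B^lo_{q,Φ̂_n,{X₁,…,X_n}}(x) and B̂_n^up(x) := B^up_{q,Φ̂_n,{X₁,…,X_n}}(x). Then for every x ∈ 𝒳, |B^lo_{q,Φ₀,D_in}(x) − B̂_n^lo(x)| → 0 in probability and |B^up_{q,Φ₀,D_in}(x) − B̂_n^up(x)|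 → 0 in probability as n → ∞. -/

import Mathlib

noncomputable section

open Filter MeasureTheory
open scoped Topology

/-- Euclidean space `ℝ^d`. -/
abbrev Euc (d : ℕ) := EuclideanSpace ℝ (Fin d)

/-- `ℓ`-th directional derivative of `f` in direction `v` at `x`. -/
def dirDeriv {d : ℕ} (ℓ : ℕ) (f : Euc d → ℝ) (v x : Euc d) : ℝ :=
  iteratedFDeriv ℝ ℓ f x (fun _ => v)

open Classical in
/-- The unit vector pointing from `x₀` to `x₁` (and `0` if `x₀ = x₁`). -/
def unitDir {d : ℕ} (x₀ x₁ : Euc d) : Euc d :=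
  if x₀ = x₁ then 0 else ‖x₁ - x₀‖⁻¹ • (x₁ - x₀)

/-- The partial Taylor sum up to order `q - 1` anchored at `x₀`, evaluated at `x`. -/
def taylorPart {d : ℕ} (q : ℕ) (f : Euc d → ℝ) (x₀ x : Euc d) : ℝ :=
  ∑ ℓ ∈ Finset.range q,
    dirDeriv ℓ f (unitDir x₀ x) x₀ * ‖x - x₀‖ ^ ℓ / (Nat.factorial ℓ : ℝ)

/-- Lower extrapolation bound `B^lo_{q,f,D}`. -/
def Blo {d : ℕ} (q : ℕ) (f : Euc d → ℝ) (D : Set (Euc d)) (x : Euc d) : ℝ :=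
  sSup ((fun x₀ => taylorPart q f x₀ x +
    sInf ((fun z => dirDeriv q f (unitDir x₀ x) z) '' D) * ‖x - x₀‖ ^ q / (Nat.factorial q : ℝ)) '' D)

/-- Upper extrapolation bound `B^up_{q,f,D}`. -/
def Bup {d : ℕ} (q : ℕ) (f : Euc d → ℝ) (D : Set (Euc d)) (x : Euc d) : ℝ :=
  sInf ((fun x₀ => taylorPart q f x₀ x +
    sSup ((fun z => dirDeriv q f (unitDir x₀ x) z) '' D) * ‖x - x₀‖ ^ q / (Nat.factorial q : ℝ)) '' D)

/-- `g` is `q`-th derivative dominated by `f` over `D` (relative to the domain `𝒳`),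
written `g ⊲_D^q f`. -/
def DerivDominated {d : ℕ} (q : ℕ) (𝒳 D : Set (Euc d)) (g f : Euc d → ℝ) : Prop :=
  ∀ v : Euc d, ‖v‖ = 1 →
    sInf ((fun z => dirDeriv q f v z) '' D) ≤ sInf ((fun x => dirDeriv q g v x) '' 𝒳) ∧
    sSup ((fun x => dirDeriv q g v x) '' 𝒳) ≤ sSup ((fun z => dirDeriv q f v z) '' D)

/-- `n`-fold partial derivative in the coordinate direction `j`. -/
def pIter {d : ℕ} (j : Fin d) : ℕ → (Euc d → ℝ) → (Euc d → ℝ)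
  | 0, f => f
  | n + 1, f => fun x => fderiv ℝ (pIter j n f) x (EuclideanSpace.single j 1)

/-- Multi-index partial derivative `∂^β f = D_{e₁}^{β₁} ⋯ D_{e_d}^{β_d} f`. -/
def multiPartialDeriv {d : ℕ} (β : Fin d → ℕ) (f : Euc d → ℝ) : Euc d → ℝ :=
  (List.finRange d).foldr (fun j g => pIter j (β j) g) f

/-- Successive partial derivatives of `f` along the coordinates listed in `L`, the head being
applied last. -/
def listDeriv {d : ℕ} (L : List (Fin d)) (f : Euc d → ℝ) : Euc d → ℝ :=
  L.foldr (fun j g x => fderiv ℝ g x (EuclideanSpace.single j 1)) f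

lemma listDeriv_cons {d : ℕ} (j : Fin d) (L : List (Fin d)) (f : Euc d → ℝ) :
    listDeriv (j :: L) f =
      fun x => fderiv ℝ (listDeriv L f) x (EuclideanSpace.single j 1) := rfl

lemma listDeriv_append {d : ℕ} (L M : List (Fin d)) (f : Euc d → ℝ) :
    listDeriv (L ++ M) f = listDeriv L (listDeriv M f) := by
  simp [listDeriv]

lemma contDiff_listDeriv {d : ℕ} (L : List (Fin d)) {f : Euc d → ℝ} (m : ℕ)
    (hf : ContDiff ℝ (m + L.length : ℕ) f) : ContDiff ℝ m (listDeriv L f) := by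
  induction L generalizing m with
  | nil => simpa [listDeriv] using hf
  | cons j L ih =>
    rw [listDeriv_cons]
    have h : ContDiff ℝ (m + 1 : ℕ) (listDeriv L f) := ih (m + 1) (by
      simpa [add_assoc, add_comm, add_left_comm] using hf)
    exact (h.fderiv_right (m := m) (by norm_cast)).clm_apply contDiff_const

lemma listDeriv_swap {d : ℕ} (i j : Fin d) {f : Euc d → ℝ} (hf : ContDiff ℝ 2 f) :
    listDeriv [i, j] f = listDeriv [j, i] f := by
  ext x
  have hs : IsSymmSndFDerivAt ℝ f x := hf.contDiffAt.isSymmSndFDerivAt (by simp)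
  have hd : DifferentiableAt ℝ (fderiv ℝ f) x :=
    ((hf.fderiv_right (m := 1) (by norm_num)).differentiable (by norm_num)) x
  have h (a b : Fin d) : listDeriv [a, b] f x =
      fderiv ℝ (fderiv ℝ f) x (EuclideanSpace.single a 1) (EuclideanSpace.single b 1) := by
    simp only [listDeriv, List.foldr]
    rw [fderiv_clm_apply hd (differentiableAt_const _)]
    simp
  rw [h, h]
  exact hs.eq _ _

lemma listDeriv_perm {d : ℕ} {L M : List (Fin d)} (h : L.Perm M) {f : Euc d → ℝ}
    (hf : ContDiff ℝ L.length f) : listDeriv L f = listDeriv M f := by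
  induction h with
  | nil => rfl
  | cons j _ ih =>
    rw [listDeriv_cons, listDeriv_cons, ih (hf.of_le (by simp))]
  | swap i j L =>
    change listDeriv [j, i] (listDeriv L f) = listDeriv [i, j] (listDeriv L f)
    refine listDeriv_swap _ _ (contDiff_listDeriv L 2 ?_)
    simpa [add_assoc, add_comm, add_left_comm] using hf
  | trans h₁ _ ih₁ ih₂ => exact (ih₁ hf).trans (ih₂ (by rwa [← h₁.length_eq]))

lemma pIter_eq_listDeriv {d : ℕ} (j : Fin d) (n : ℕ) (f : Euc d → ℝ) :
    pIter j n f = listDeriv (List.replicate n j) f := by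
  induction n with
  | zero => rfl
  | succ n ih => rw [List.replicate_succ, listDeriv_cons, ← ih]; rfl

lemma multiPartialDeriv_eq_listDeriv {d : ℕ} (β : Fin d → ℕ) (f : Euc d → ℝ) :
    multiPartialDeriv β f =
      listDeriv ((List.finRange d).flatMap fun j => List.replicate (β j) j) f := by
  unfold multiPartialDeriv
  induction List.finRange d with
  | nil => rfl
  | cons j L ih => rw [List.foldr_cons, ih, List.flatMap_cons, listDeriv_append,
      pIter_eq_listDeriv]

lemma length_flatMap_replicate {d : ℕ} (β : Fin d → ℕ) :
    ((List.finRange d).flatMap fun j => List.replicate (β j) j).length = ∑ j, β j := by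
  simp [List.length_flatMap, Fin.sum_univ_def]

lemma perm_flatMap_replicate_count {d : ℕ} (L : List (Fin d)) :
    L.Perm ((List.finRange d).flatMap fun j => List.replicate (L.count j) j) := by
  rw [List.perm_iff_count]
  intro a
  rw [List.count_flatMap]
  simp [Function.comp_def, List.count_replicate, ← Fin.sum_univ_def]

lemma continuous_multiPartialDeriv {d q : ℕ} {β : Fin d → ℕ} (hβ : ∑ j, β j ≤ q)
    {f : Euc d → ℝ} (hf : ContDiff ℝ q f) : Continuous (multiPartialDeriv β f) := by
  rw [multiPartialDeriv_eq_listDeriv]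
  refine (contDiff_listDeriv _ 0 (hf.of_le ?_)).continuous
  rw [length_flatMap_replicate]
  exact_mod_cast (by omega)

lemma iteratedFDeriv_single_eq_listDeriv {d ℓ : ℕ} (s : Fin ℓ → Fin d) {f : Euc d → ℝ}
    (hf : ContDiff ℝ ℓ f) (x : Euc d) :
    iteratedFDeriv ℝ ℓ f x (fun i => EuclideanSpace.single (s i) 1) =
      listDeriv (List.ofFn s) f x := by
  induction ℓ generalizing x with
  | zero => simp [listDeriv]
  | succ ℓ ih =>
    have hf' : ContDiff ℝ ℓ f := hf.of_le (by norm_cast; omega)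
    rw [List.ofFn_succ, listDeriv_cons, iteratedFDeriv_succ_apply_left]
    have hd : DifferentiableAt ℝ (iteratedFDeriv ℝ ℓ f) x :=
      (hf.differentiable_iteratedFDeriv (by norm_cast; omega)) x
    have : listDeriv (List.ofFn fun i => s i.succ) f =
        fun y => iteratedFDeriv ℝ ℓ f y (fun i => EuclideanSpace.single (s i.succ) 1) := by
      ext y
      exact (ih _ hf' y).symm
    rw [this]
    beta_reduce
    have := (hd.hasFDerivAt.continuousMultilinear_apply_const
      (fun i => (EuclideanSpace.single (s i.succ) 1 : Euc d))).fderiv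
    rw [this]
    rfl

lemma exists_iteratedFDeriv_single_eq_multiPartialDeriv {d ℓ : ℕ} (s : Fin ℓ → Fin d) :
    ∃ β : Fin d → ℕ, ∑ j, β j = ℓ ∧ ∀ f : Euc d → ℝ, ContDiff ℝ ℓ f → ∀ x,
      iteratedFDeriv ℝ ℓ f x (fun i => EuclideanSpace.single (s i) 1) =
        multiPartialDeriv β f x := by
  have hp := perm_flatMap_replicate_count (List.ofFn s)
  refine ⟨fun j => (List.ofFn s).count j, ?_, fun f hf x => ?_⟩
  · rw [← length_flatMap_replicate, ← hp.length_eq, List.length_ofFn]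
  · rw [iteratedFDeriv_single_eq_listDeriv s hf, multiPartialDeriv_eq_listDeriv,
      listDeriv_perm hp (by simpa using hf)]

lemma dirDeriv_eq_sum {d ℓ : ℕ} (f : Euc d → ℝ) (v x : Euc d) :
    dirDeriv ℓ f v x = ∑ s : Fin ℓ → Fin d,
      (∏ i, v (s i)) * iteratedFDeriv ℝ ℓ f x (fun i => EuclideanSpace.single (s i) 1) := by
  have hv : v = ∑ j, v j • (EuclideanSpace.single j 1 : Euc d) := by
    ext i
    simp [Finset.sum_apply, Pi.single_apply]
  unfold dirDeriv
  conv_lhs => rw [hv]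
  rw [ContinuousMultilinearMap.map_sum]
  refine Finset.sum_congr rfl fun s _ => ?_
  rw [ContinuousMultilinearMap.map_smul_univ, smul_eq_mul]

lemma abs_dirDeriv_sub_le {d ℓ : ℕ} {f g : Euc d → ℝ} (hf : ContDiff ℝ ℓ f)
    (hg : ContDiff ℝ ℓ g) {x v : Euc d} {η R : ℝ} (hv : ‖v‖ ≤ R)
    (h : ∀ β : Fin d → ℕ, ∑ j, β j = ℓ →
      |multiPartialDeriv β f x - multiPartialDeriv β g x| ≤ η) :
    |dirDeriv ℓ f v x - dirDeriv ℓ g v x| ≤ (d * R) ^ ℓ * η := by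
  rw [dirDeriv_eq_sum, dirDeriv_eq_sum, ← Finset.sum_sub_distrib]
  refine (Finset.abs_sum_le_sum_abs _ _).trans ?_
  have key : ∀ s ∈ (Finset.univ : Finset (Fin ℓ → Fin d)), |(∏ i, v (s i)) *
      iteratedFDeriv ℝ ℓ f x (fun i => EuclideanSpace.single (s i) 1) - (∏ i, v (s i)) *
      iteratedFDeriv ℝ ℓ g x (fun i => EuclideanSpace.single (s i) 1)| ≤ R ^ ℓ * η := by
    intro s _
    obtain ⟨β, hβ, hD⟩ := exists_iteratedFDeriv_single_eq_multiPartialDeriv s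
    rw [hD f hf, hD g hg, ← mul_sub, abs_mul]
    have hprod : |∏ i, v (s i)| ≤ R ^ ℓ := by
      rw [Finset.abs_prod]
      refine (Finset.prod_le_prod (fun _ _ => abs_nonneg _)
        (fun i _ => ?_)).trans_eq (by simp : ∏ _i : Fin ℓ, R = R ^ ℓ)
      exact (PiLp.norm_apply_le v (s i)).trans hv
    exact mul_le_mul hprod (h β hβ) (abs_nonneg _) ((abs_nonneg _).trans hprod)
  refine (Finset.sum_le_sum key).trans_eq ?_
  simp [mul_pow, mul_assoc]

lemma continuous_dirDeriv {d q ℓ : ℕ} (hℓ : ℓ ≤ q) {f : Euc d → ℝ} (hf : ContDiff ℝ q f) :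
    Continuous fun p : Euc d × Euc d => dirDeriv ℓ f p.1 p.2 := by
  have h := (hf.continuous_iteratedFDeriv (m := ℓ) (by exact_mod_cast hℓ))
  simp only [dirDeriv_eq_sum]
  refine continuous_finsetSum _ fun s _ => Continuous.mul ?_ ?_
  · exact continuous_finsetProd _ fun i _ => by fun_prop
  · exact (continuous_eval_const _).comp (h.comp continuous_snd)

lemma dirDeriv_smul {d ℓ : ℕ} (f : Euc d → ℝ) (c : ℝ) (v x : Euc d) :
    dirDeriv ℓ f (c • v) x = c ^ ℓ * dirDeriv ℓ f v x := by
  unfold dirDeriv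
  rw [ContinuousMultilinearMap.map_smul_univ]
  simp

lemma norm_smul_unitDir {d : ℕ} (x₀ x : Euc d) : ‖x - x₀‖ • unitDir x₀ x = x - x₀ := by
  unfold unitDir
  split_ifs with h
  · simp [h]
  · rw [smul_smul, mul_inv_cancel₀ (norm_ne_zero_iff.2 (sub_ne_zero.2 (Ne.symm h))), one_smul]

lemma dirDeriv_unitDir_mul {d ℓ : ℕ} (f : Euc d → ℝ) (x₀ x z : Euc d) :
    dirDeriv ℓ f (unitDir x₀ x) z * ‖x - x₀‖ ^ ℓ = dirDeriv ℓ f (x - x₀) z := by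
  conv_rhs => rw [← norm_smul_unitDir x₀ x, dirDeriv_smul, mul_comm]

/-- The Taylor polynomial at `x₀`, evaluated at `x`, with the derivative of order `q` taken
at `z`. -/
def taylorAt {d : ℕ} (q : ℕ) (f : Euc d → ℝ) (x x₀ z : Euc d) : ℝ :=
  ∑ ℓ ∈ Finset.range q, dirDeriv ℓ f (x - x₀) x₀ / (Nat.factorial ℓ : ℝ) +
    dirDeriv q f (x - x₀) z / (Nat.factorial q : ℝ)

lemma taylorPart_add_eq_taylorAt {d q : ℕ} (f : Euc d → ℝ) (x x₀ z : Euc d) :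
    taylorPart q f x₀ x + dirDeriv q f (unitDir x₀ x) z * ‖x - x₀‖ ^ q / (Nat.factorial q : ℝ) =
      taylorAt q f x x₀ z := by
  simp only [taylorPart, taylorAt, dirDeriv_unitDir_mul]

lemma continuous_taylorAt {d q : ℕ} {f : Euc d → ℝ} (hf : ContDiff ℝ q f) (x : Euc d) :
    Continuous fun p : Euc d × Euc d => taylorAt q f x p.1 p.2 := by
  unfold taylorAt
  refine Continuous.add (continuous_finsetSum _ fun ℓ hℓ => ?_) ?_
  · exact ((continuous_dirDeriv (Finset.mem_range.1 hℓ).le hf).comp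
      (f := fun p : Euc d × Euc d => (x - p.1, p.1)) (by fun_prop)).div_const _
  · exact ((continuous_dirDeriv le_rfl hf).comp
      (f := fun p : Euc d × Euc d => (x - p.1, p.2)) (by fun_prop)).div_const _

lemma abs_taylorAt_sub_le {d q : ℕ} {f g : Euc d → ℝ} (hf : ContDiff ℝ q f)
    (hg : ContDiff ℝ q g) {D : Set (Euc d)} {x x₀ z : Euc d} (hx₀ : x₀ ∈ D) (hz : z ∈ D)
    {η R : ℝ} (hR : ‖x - x₀‖ ≤ R)
    (h : ∀ β : Fin d → ℕ, ∑ j, β j ≤ q → ∀ y ∈ D,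
      |multiPartialDeriv β f y - multiPartialDeriv β g y| ≤ η) :
    |taylorAt q f x x₀ z - taylorAt q g x x₀ z| ≤
      (∑ ℓ ∈ Finset.range (q + 1), (d * R) ^ ℓ) * η := by
  have key : ∀ ℓ ≤ q, ∀ y ∈ D, |dirDeriv ℓ f (x - x₀) y / (Nat.factorial ℓ : ℝ) -
      dirDeriv ℓ g (x - x₀) y / (Nat.factorial ℓ : ℝ)| ≤ (d * R) ^ ℓ * η := by
    intro ℓ hℓ y hy
    rw [← sub_div, abs_div, Nat.abs_cast]
    refine (div_le_self (abs_nonneg _) (by exact_mod_cast ℓ.factorial_pos)).trans ?_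
    exact abs_dirDeriv_sub_le (hf.of_le (by exact_mod_cast hℓ)) (hg.of_le (by exact_mod_cast hℓ))
      hR fun β hβ => h β (hβ.le.trans hℓ) y hy
  unfold taylorAt
  rw [add_sub_add_comm, ← Finset.sum_sub_distrib, Finset.sum_mul, Finset.sum_range_succ]
  refine (abs_add_le _ _).trans (add_le_add ?_ (key q le_rfl z hz))
  exact (Finset.abs_sum_le_sum_abs _ _).trans
    (Finset.sum_le_sum fun ℓ hℓ => key ℓ (Finset.mem_range.1 hℓ).le x₀ hx₀)

lemma Blo_eq {d q : ℕ} {f : Euc d → ℝ} (hf : ContDiff ℝ q f) {D : Set (Euc d)}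
    (hD : IsCompact D) (hne : D.Nonempty) (x : Euc d) :
    Blo q f D x = sSup ((fun x₀ => sInf (taylorAt q f x x₀ '' D)) '' D) := by
  unfold Blo
  congr 2
  ext x₀
  have hm : Monotone fun t : ℝ =>
      taylorPart q f x₀ x + t * ‖x - x₀‖ ^ q / (Nat.factorial q : ℝ) := by
    intro s t hst
    dsimp only
    gcongr
  have hc : Continuous fun z => dirDeriv q f (unitDir x₀ x) z :=
    (continuous_dirDeriv le_rfl hf).comp (f := fun z => (unitDir x₀ x, z)) (by fun_prop)
  have := hm.map_csInf_of_continuousAt (Continuous.continuousAt (by fun_prop))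
    (hne.image fun z => dirDeriv q f (unitDir x₀ x) z) (hD.image hc).bddBelow
  rw [this, Set.image_image]
  simp only [taylorPart_add_eq_taylorAt]

lemma Bup_eq {d q : ℕ} {f : Euc d → ℝ} (hf : ContDiff ℝ q f) {D : Set (Euc d)}
    (hD : IsCompact D) (hne : D.Nonempty) (x : Euc d) :
    Bup q f D x = sInf ((fun x₀ => sSup (taylorAt q f x x₀ '' D)) '' D) := by
  unfold Bup
  congr 2
  ext x₀
  have hm : Monotone fun t : ℝ =>
      taylorPart q f x₀ x + t * ‖x - x₀‖ ^ q / (Nat.factorial q : ℝ) := by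
    intro s t hst
    dsimp only
    gcongr
  have hc : Continuous fun z => dirDeriv q f (unitDir x₀ x) z :=
    (continuous_dirDeriv le_rfl hf).comp (f := fun z => (unitDir x₀ x, z)) (by fun_prop)
  have := hm.map_csSup_of_continuousAt (Continuous.continuousAt (by fun_prop))
    (hne.image fun z => dirDeriv q f (unitDir x₀ x) z) (hD.image hc).bddAbove
  rw [this, Set.image_image]
  simp only [taylorPart_add_eq_taylorAt]

lemma abs_sSup_sInf_sub_le {E : Type*} [PseudoMetricSpace E] {D S : Set E} (hSD : S ⊆ D)
    (hS : S.Nonempty) {F G : E → E → ℝ} {ε ρ M : ℝ}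
    (hM : ∀ a ∈ D, ∀ b ∈ D, |F a b| ≤ M)
    (hF : ∀ a ∈ D, ∀ b ∈ D, ∀ a' ∈ D, ∀ b' ∈ D, dist a a' ≤ ρ → dist b b' ≤ ρ →
      |F a b - F a' b'| ≤ ε)
    (hFG : ∀ a ∈ D, ∀ b ∈ D, |G a b - F a b| ≤ ε)
    (hcov : ∀ z ∈ D, ∃ y ∈ S, dist z y ≤ ρ) :
    |sSup ((fun a => sInf (F a '' D)) '' D) - sSup ((fun a => sInf (G a '' S)) '' S)|
      ≤ 2 * ε := by
  obtain ⟨s, hs⟩ := hS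
  have hρ : 0 ≤ ρ := by
    obtain ⟨y, -, hy⟩ := hcov s (hSD hs)
    exact dist_nonneg.trans hy
  have hFb (a) (ha : a ∈ D) : BddBelow (F a '' D) :=
    ⟨-M, by rintro _ ⟨b, hb, rfl⟩; exact (abs_le.1 (hM a ha b hb)).1⟩
  have hGb (a) (ha : a ∈ S) : BddBelow (G a '' S) := by
    refine ⟨-M - ε, ?_⟩
    rintro _ ⟨b, hb, rfl⟩
    have h₁ := abs_le.1 (hM a (hSD ha) b (hSD hb))
    have h₂ := abs_le.1 (hFG a (hSD ha) b (hSD hb))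
    linarith
  have hFs : BddAbove ((fun a => sInf (F a '' D)) '' D) := by
    refine ⟨M, ?_⟩
    rintro _ ⟨a, ha, rfl⟩
    exact (csInf_le (hFb a ha) ⟨a, ha, rfl⟩).trans (abs_le.1 (hM a ha a ha)).2
  have hlow (a) (ha : a ∈ S) : sInf (G a '' S) ≤ sInf (F a '' D) + 2 * ε := by
    rw [← sub_le_iff_le_add]
    refine le_csInf ⟨_, a, hSD ha, rfl⟩ ?_
    rintro _ ⟨b, hb, rfl⟩
    obtain ⟨y, hy, hby⟩ := hcov b hb
    have h₁ := csInf_le (hGb a ha) ⟨y, hy, rfl⟩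
    have h₂ := abs_le.1 (hFG a (hSD ha) y (hSD hy))
    have h₃ := abs_le.1 (hF a (hSD ha) b hb a (hSD ha) y (hSD hy) (by simpa using hρ) hby)
    linarith
  have hGs : BddAbove ((fun a => sInf (G a '' S)) '' S) := by
    obtain ⟨B, hB⟩ := hFs
    refine ⟨B + 2 * ε, ?_⟩
    rintro _ ⟨a, ha, rfl⟩
    have := hB ⟨a, hSD ha, rfl⟩
    dsimp only at this ⊢
    linarith [hlow a ha]
  have h₁ : sSup ((fun a => sInf (G a '' S)) '' S) ≤
      sSup ((fun a => sInf (F a '' D)) '' D) + 2 * ε := by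
    refine csSup_le ⟨_, s, hs, rfl⟩ ?_
    rintro _ ⟨a, ha, rfl⟩
    have := le_csSup hFs ⟨a, hSD ha, rfl⟩
    dsimp only at this ⊢
    linarith [hlow a ha]
  have h₂ : sSup ((fun a => sInf (F a '' D)) '' D) ≤
      sSup ((fun a => sInf (G a '' S)) '' S) + 2 * ε := by
    refine csSup_le ⟨_, s, hSD hs, rfl⟩ ?_
    rintro _ ⟨a, ha, rfl⟩
    obtain ⟨y, hy, hay⟩ := hcov a ha
    have h₃ : sInf (F a '' D) - 2 * ε ≤ sInf (G y '' S) := by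
      refine le_csInf ⟨_, s, hs, rfl⟩ ?_
      rintro _ ⟨b, hb, rfl⟩
      have h₄ := csInf_le (hFb a ha) ⟨b, hSD hb, rfl⟩
      have h₅ := abs_le.1 (hFG y (hSD hy) b (hSD hb))
      have h₆ := abs_le.1 (hF a ha b (hSD hb) y (hSD hy) b (hSD hb) hay (by simpa using hρ))
      linarith
    have := le_csSup hGs ⟨y, hy, rfl⟩
    dsimp only at this ⊢
    linarith
  rw [abs_le]
  constructor <;> linarith

lemma sInf_sSup_eq_neg {E : Type*} (D : Set E) (F : E → E → ℝ) :
    sInf ((fun a => sSup (F a '' D)) '' D) =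
      -sSup ((fun a => sInf ((fun b => -F a b) '' D)) '' D) := by
  have h (T : Set E) (g : E → ℝ) : sInf ((fun b => -g b) '' T) = -sSup (g '' T) := by
    rw [Real.sInf_def, ← Set.image_neg_eq_neg, Set.image_image]
    simp
  have h' := h D fun a => -sSup (F a '' D)
  simp only [neg_neg] at h'
  rw [h']
  simp only [h]

lemma abs_sInf_sSup_sub_le {E : Type*} [PseudoMetricSpace E] {D S : Set E} (hSD : S ⊆ D)
    (hS : S.Nonempty) {F G : E → E → ℝ} {ε ρ M : ℝ}
    (hM : ∀ a ∈ D, ∀ b ∈ D, |F a b| ≤ M)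
    (hF : ∀ a ∈ D, ∀ b ∈ D, ∀ a' ∈ D, ∀ b' ∈ D, dist a a' ≤ ρ → dist b b' ≤ ρ →
      |F a b - F a' b'| ≤ ε)
    (hFG : ∀ a ∈ D, ∀ b ∈ D, |G a b - F a b| ≤ ε)
    (hcov : ∀ z ∈ D, ∃ y ∈ S, dist z y ≤ ρ) :
    |sInf ((fun a => sSup (F a '' D)) '' D) - sInf ((fun a => sSup (G a '' S)) '' S)|
      ≤ 2 * ε := by
  rw [sInf_sSup_eq_neg, sInf_sSup_eq_neg, neg_sub_neg, abs_sub_comm]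
  refine abs_sSup_sInf_sub_le (F := fun a b => -F a b) (G := fun a b => -G a b) hSD hS
    (M := M) (ρ := ρ) ?_ ?_ ?_ hcov
  · simpa using hM
  · intro a ha b hb a' ha' b' hb' h h'
    rw [neg_sub_neg, abs_sub_comm]
    exact hF a ha b hb a' ha' b' hb' h h'
  · intro a ha b hb
    rw [neg_sub_neg, abs_sub_comm]
    exact hFG a ha b hb

/-- Deterministic stability of both extrapolation bounds under perturbation of the function and
replacement of the domain by a sufficiently dense finite subset. -/
lemma exists_abs_Blo_Bup_sub_le {q d : ℕ} {D : Set (Euc d)} (hD : IsCompact D)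
    {f : Euc d → ℝ} (hf : ContDiff ℝ q f) (x : Euc d) {δ : ℝ} (hδ : 0 < δ) :
    ∃ η > 0, ∃ ρ > 0, ∀ g : Euc d → ℝ, ContDiff ℝ q g →
      ∀ S : Set (Euc d), S.Finite → S.Nonempty → S ⊆ D →
      (∀ β : Fin d → ℕ, ∑ j, β j ≤ q → ∀ y ∈ D,
        |multiPartialDeriv β g y - multiPartialDeriv β f y| ≤ η) →
      (∀ z ∈ D, ∃ y ∈ S, dist z y ≤ ρ) →
      |Blo q f D x - Blo q g S x| ≤ δ ∧ |Bup q f D x - Bup q g S x| ≤ δ := by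
  have hc := continuous_taylorAt hf x
  obtain ⟨M, hM⟩ := (hD.prod hD).exists_bound_of_continuousOn hc.continuousOn
  obtain ⟨r, hr, hu⟩ := Metric.uniformContinuousOn_iff.1
    ((hD.prod hD).uniformContinuousOn_of_continuous hc.continuousOn) (δ / 2) (by positivity)
  obtain ⟨R', hR'⟩ := hD.exists_bound_of_continuousOn
    (f := fun y => x - y) (by fun_prop)
  set R := max R' 0
  have hR : ∀ y ∈ D, ‖x - y‖ ≤ R := fun y hy => (hR' y hy).trans (le_max_left _ _)
  have hR0 : 0 ≤ R := le_max_right _ _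
  set C := ∑ ℓ ∈ Finset.range (q + 1), (d * R) ^ ℓ
  have hC : 0 ≤ C := Finset.sum_nonneg fun _ _ => by positivity
  refine ⟨δ / 2 / (C + 1), by positivity, r / 2, by positivity, ?_⟩
  intro g hg S hSfin hSne hSD hβ hcov
  have hFG : ∀ a ∈ D, ∀ b ∈ D, |taylorAt q g x a b - taylorAt q f x a b| ≤ δ / 2 := by
    intro a ha b hb
    refine (abs_taylorAt_sub_le hg hf ha hb (hR a ha) hβ).trans ?_
    rw [mul_div_assoc', div_le_iff₀ (by positivity)]
    nlinarith
  have hF : ∀ a ∈ D, ∀ b ∈ D, ∀ a' ∈ D, ∀ b' ∈ D, dist a a' ≤ r / 2 → dist b b' ≤ r / 2 →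
      |taylorAt q f x a b - taylorAt q f x a' b'| ≤ δ / 2 := by
    intro a ha b hb a' ha' b' hb' h h'
    refine (hu (a, b) ⟨ha, hb⟩ (a', b') ⟨ha', hb'⟩ ?_).le
    rw [Prod.dist_eq]
    exact (max_le h h').trans_lt (by linarith)
  have hM' : ∀ a ∈ D, ∀ b ∈ D, |taylorAt q f x a b| ≤ M := fun a ha b hb => hM (a, b) ⟨ha, hb⟩
  rw [Blo_eq hf hD (hSne.mono hSD), Blo_eq hg hSfin.isCompact hSne,
    Bup_eq hf hD (hSne.mono hSD), Bup_eq hg hSfin.isCompact hSne, (by ring : δ = 2 * (δ / 2))]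
  exact ⟨abs_sSup_sInf_sub_le hSD hSne hM' hF hFG hcov,
    abs_sInf_sSup_sub_le hSD hSne hM' hF hFG hcov⟩

/-- A covering radius at most `ρ` yields a sample point within `ρ` of every point of `D`. -/
lemma exists_dist_le_of_sSup_sInf_le {E : Type*} [NormedAddCommGroup E] {D : Set E}
    (hD : IsCompact D) {Y : ℕ → E} {n : ℕ} (hn : 0 < n) {ρ : ℝ}
    (h : sSup ((fun z => sInf ((fun k => ‖Y k - z‖) '' Set.Iio n)) '' D) ≤ ρ) :
    ∀ z ∈ D, ∃ y ∈ Y '' Set.Iio n, dist z y ≤ ρ := by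
  intro z hz
  have hfin (w : E) : ((fun k => ‖Y k - w‖) '' Set.Iio n).Finite := (Set.finite_Iio n).image _
  have hb : BddAbove ((fun z => sInf ((fun k => ‖Y k - z‖) '' Set.Iio n)) '' D) := by
    obtain ⟨B, hB⟩ := hD.exists_bound_of_continuousOn (f := fun w => Y 0 - w) (by fun_prop)
    refine ⟨B, ?_⟩
    rintro _ ⟨w, hw, rfl⟩
    exact (csInf_le (hfin w).bddBelow ⟨0, hn, rfl⟩).trans (hB w hw)
  obtain ⟨k, hk, hkz⟩ := Set.Nonempty.csInf_mem
    (s := (fun k => ‖Y k - z‖) '' Set.Iio n) ⟨_, 0, hn, rfl⟩ (hfin z)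
  refine ⟨Y k, ⟨k, hk, rfl⟩, ?_⟩
  rw [dist_comm, dist_eq_norm]
  exact hkz.trans_le ((le_csSup hb ⟨z, hz, rfl⟩).trans h)

/-- Theorem 2 of the paper, consistency of the plug-in extrapolation
bound estimates: if the estimated conditional function and all its partial derivatives
up to order `q` are uniformly consistent on `D_in` in probability, and the covering
radius `Λ_n` of the sample points tends to `0` in probability, then the plug-in
extrapolation bound estimates (optimizing only over the sample points) are pointwise
consistent in probability. -/
theorem consistency_of_extrapolation_bound_estimates
    {q d : ℕ} (hq : 1 ≤ q) (hd : 1 ≤ d)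
    (𝒳 : Set (Euc d)) (h𝒳 : IsCompact 𝒳)
    (Din : Set (Euc d)) (hsub : Din ⊆ 𝒳) (hne : Din.Nonempty) (hcl : IsClosed Din)
    (Φ₀ : Euc d → ℝ) (hΦ₀ : ContDiff ℝ (q + 1 : ℕ) Φ₀)
    {Ω : Type} [MeasurableSpace Ω] (P : Measure Ω) [IsProbabilityMeasure P]
    (X : ℕ → Ω → Euc d) (hX : ∀ k ω, X k ω ∈ Din)
    (Φhat : ℕ → Ω → Euc d → ℝ) (hΦhat : ∀ n ω, ContDiff ℝ q (Φhat n ω))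
    (ha : ∀ β : Fin d → ℕ, (∑ j, β j) ≤ q → ∀ δ > (0 : ℝ),
      Tendsto (fun n => P {ω | δ <
          sSup ((fun x => |multiPartialDeriv β (Φhat n ω) x - multiPartialDeriv β Φ₀ x|)
            '' Din)}) atTop (𝓝 0))
    (hb : ∀ δ > (0 : ℝ),
      Tendsto (fun n => P {ω | δ <
          sSup ((fun z => sInf ((fun k => ‖X k ω - z‖) '' Set.Iio n)) '' Din)})
        atTop (𝓝 0)) :
    ∀ x ∈ 𝒳, ∀ δ > (0 : ℝ),
      Tendsto (fun n => P {ω | δ <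
          |Blo q Φ₀ Din x - Blo q (Φhat n ω) ((fun k => X k ω) '' Set.Iio n) x|})
        atTop (𝓝 0) ∧
      Tendsto (fun n => P {ω | δ <
          |Bup q Φ₀ Din x - Bup q (Φhat n ω) ((fun k => X k ω) '' Set.Iio n) x|})
        atTop (𝓝 0) := by
  intro x _ δ hδ
  have hD : IsCompact Din := h𝒳.of_isClosed_subset hcl hsub
  have hf : ContDiff ℝ q Φ₀ := hΦ₀.of_le (by norm_cast; omega)
  obtain ⟨η, hη, ρ, hρ, hstab⟩ := exists_abs_Blo_Bup_sub_le hD hf x hδ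
  set A : (Fin d → ℕ) → ℕ → Set Ω := fun β n => {ω | η <
    sSup ((fun x => |multiPartialDeriv β (Φhat n ω) x - multiPartialDeriv β Φ₀ x|) '' Din)}
  set C : ℕ → Set Ω := fun n => {ω | ρ <
    sSup ((fun z => sInf ((fun k => ‖X k ω - z‖) '' Set.Iio n)) '' Din)}
  set I : Finset (Fin d → ℕ) :=
    (Fintype.piFinset fun _ => Finset.range (q + 1)).filter fun β => ∑ j, β j ≤ q
  have hI {β : Fin d → ℕ} : β ∈ I ↔ ∑ j, β j ≤ q := by
    simp only [I, Finset.mem_filter, Fintype.mem_piFinset, Finset.mem_range,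
      and_iff_right_iff_imp]
    intro h j
    have := Finset.single_le_sum (f := β) (fun _ _ => Nat.zero_le _) (Finset.mem_univ j)
    omega
  have hlim : Tendsto (fun n => ∑ β ∈ I, P (A β n) + P (C n)) atTop (𝓝 0) := by
    have := (tendsto_finsetSum I fun β hβ => ha β (hI.1 hβ) η hη).add (hb ρ hρ)
    simpa using this
  have hgood {n : ℕ} (hn : 0 < n) {ω : Ω} (hω : ω ∉ (⋃ β ∈ I, A β n) ∪ C n) :
      |Blo q Φ₀ Din x - Blo q (Φhat n ω) ((fun k => X k ω) '' Set.Iio n) x| ≤ δ ∧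
      |Bup q Φ₀ Din x - Bup q (Φhat n ω) ((fun k => X k ω) '' Set.Iio n) x| ≤ δ := by
    simp only [Set.mem_union, Set.mem_iUnion, not_or, not_exists, A, C, Set.mem_ofPred_eq,
      not_lt] at hω
    refine hstab _ (hΦhat n ω) _ ((Set.finite_Iio n).image _) ⟨_, 0, hn, rfl⟩
      (by rintro _ ⟨k, -, rfl⟩; exact hX k ω) ?_
      (exists_dist_le_of_sSup_sInf_le hD hn hω.2)
    intro β hβ y hy
    have hc := ((continuous_multiPartialDeriv hβ (hΦhat n ω)).sub
      (continuous_multiPartialDeriv hβ hf)).abs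
    exact (le_csSup (hD.image hc).bddAbove ⟨y, hy, rfl⟩).trans (hω.1 β (hI.2 hβ))
  have hsqueeze (B : ℕ → Set Ω) (hB : ∀ n > 0, B n ⊆ (⋃ β ∈ I, A β n) ∪ C n) :
      Tendsto (fun n => P (B n)) atTop (𝓝 0) := by
    refine tendsto_of_tendsto_of_tendsto_of_le_of_le' tendsto_const_nhds hlim
      (Eventually.of_forall fun _ => zero_le) ?_
    filter_upwards [eventually_gt_atTop 0] with n hn
    calc P (B n) ≤ P ((⋃ β ∈ I, A β n) ∪ C n) := measure_mono (hB n hn)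
      _ ≤ P (⋃ β ∈ I, A β n) + P (C n) := measure_union_le _ _
      _ ≤ _ := by gcongr; exact measure_biUnion_finset_le _ _
  constructor
  · refine hsqueeze _ fun n hn ω hω => ?_
    by_contra h
    exact absurd (hgood hn h).1 (not_le.2 hω)
  · refine hsqueeze _ fun n hn ω hω => ?_
    by_contra h
    exact absurd (hgood hn h).2 (not_le.2 hω)
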